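/- arXiv:2301.06420 — 4 statements merged into one kernel-verified Lean document; each statement's English description precedes it below -/
import Mathlib

section
/- Let L ⊣ R (L : X ⥤ A, R : A ⥤ X, unit η, counit ε) and L' ⊣ R' (L' : X' ⥤ A', R' : A' ⥤ X', unit η', counit ε') be adjunctions of categories, and let F : X ⥤ X', G : A ⥤ A' be functors with L ⋙ G = F ⋙ L'. Let T and T' be the monads on X and X' induced by these adjunctions (underlying functors L ⋙ R and L' ⋙ R', units η and η', multiplications with components R(ε_{L x}) and R'(ε'_{L' x'})). Define ν : R ⋙ F ⟶ G ⋙ R' as the mate of the identity square, with components ν_a : F(R a) → R'(G a) given by the composite F(R a) → R'(L'(F(R a))) = R'(G(L(R a))) → R'(G a) (first η'_{F(R a)}, then R'(G(ε_a)), using L ⋙ G = F ⋙ L'). Then the natural transformation φ : T ⋙ F ⟶ F ⋙ T' with components φ_x := ν_{L x} : F(R(L x)) → R'(G(L x)) = R'(L'(F x)) is a colax monad morphism from T to T' over F. (This is Lemma 4.3 of the paper specialized to the identity 2-monad on Cat.) -/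
open CategoryTheory

universe v₁ v₂ v₃ v₄ u₁ u₂ u₃ u₄

/-- A colax monad morphism from a monad `T` on `C` to a monad `S` on `D` over a functor
`F : C ⥤ D`: a natural transformation `φ` with components `φ_X : F (T X) ⟶ S (F X)` such that
`φ_X ∘ F (η^T_X) = η^S_{F X}` and
`φ_X ∘ F (μ^T_X) = μ^S_{F X} ∘ S (φ_X) ∘ φ_{T X}`. -/
def IsColaxMonadMorphism {C : Type u₁} [Category.{v₁} C] {D : Type u₂} [Category.{v₂} D]
    (T : Monad C) (S : Monad D) (F : C ⥤ D)
    (φ : T.toFunctor ⋙ F ⟶ F ⋙ S.toFunctor) : Prop :=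
  (∀ X : C, F.map (T.η.app X) ≫ φ.app X = S.η.app (F.obj X)) ∧
  (∀ X : C, F.map (T.μ.app X) ≫ φ.app X =
      φ.app (T.obj X) ≫ S.map (φ.app X) ≫ S.μ.app (F.obj X))

section Mate

variable {X : Type u₁} [Category.{v₁} X] {A : Type u₂} [Category.{v₂} A]
  {X' : Type u₃} [Category.{v₃} X'] {A' : Type u₄} [Category.{v₄} A']
  {L : X ⥤ A} {R : A ⥤ X} (adj : L ⊣ R)
  {L' : X' ⥤ A'} {R' : A' ⥤ X'} (adj' : L' ⊣ R')
  {F : X ⥤ X'} {G : A ⥤ A'}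
  (e : ∀ x, L'.obj (F.obj x) ≅ G.obj (L.obj x))

/-- The mate, transposed along `L' ⊣ R'` and evaluated at `L.obj x`. -/
def transposedMate (x : X) : L'.obj (F.obj (R.obj (L.obj x))) ⟶ L'.obj (F.obj x) :=
  (e (R.obj (L.obj x))).hom ≫ G.map (adj.counit.app (L.obj x)) ≫ (e x).inv

lemma map_unit_comp_transposedMate
    (he : ∀ {x y : X} (f : x ⟶ y),
      L'.map (F.map f) ≫ (e y).hom = (e x).hom ≫ G.map (L.map f)) (x : X) :
    F.map (adj.unit.app x) ≫ adj'.homEquiv _ _ (transposedMate adj e x) =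
      adj'.unit.app (F.obj x) := by
  have h : L'.map (F.map (adj.unit.app x)) ≫ transposedMate adj e x = 𝟙 _ := by
    have h₁ := he (adj.unit.app x)
    have h₂ : G.map (L.map (adj.unit.app x)) ≫ G.map (adj.counit.app (L.obj x)) =
        𝟙 (G.obj (L.obj x)) :=
      (G.map_comp _ _).symm.trans
        ((congrArg G.map (adj.left_triangle_components x)).trans (G.map_id _))
    calc
      _ = (L'.map (F.map (adj.unit.app x)) ≫ (e (R.obj (L.obj x))).hom) ≫
          G.map (adj.counit.app (L.obj x)) ≫ (e x).inv := (Category.assoc _ _ _).symm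
      _ = ((e x).hom ≫ G.map (L.map (adj.unit.app x))) ≫
          G.map (adj.counit.app (L.obj x)) ≫ (e x).inv := congrArg (· ≫ _) h₁
      _ = (e x).hom ≫ (G.map (L.map (adj.unit.app x)) ≫ G.map (adj.counit.app (L.obj x))) ≫
          (e x).inv := by simp only [Category.assoc]
      _ = 𝟙 _ := by
        rw [h₂]
        simp
  exact (adj'.homEquiv_naturality_left _ _).symm.trans
    ((congrArg (adj'.homEquiv _ _) h).trans (adj'.homEquiv_id _))

lemma map_counit_comp_transposedMate
    (he : ∀ {x y : X} (f : x ⟶ y),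
      L'.map (F.map f) ≫ (e y).hom = (e x).hom ≫ G.map (L.map f)) (x : X) :
    F.map (R.map (adj.counit.app (L.obj x))) ≫ adj'.homEquiv _ _ (transposedMate adj e x) =
      adj'.homEquiv _ _ (transposedMate adj e (R.obj (L.obj x))) ≫
        R'.map (L'.map (adj'.homEquiv _ _ (transposedMate adj e x))) ≫
          R'.map (adj'.counit.app (L'.obj (F.obj x))) := by
  have h : L'.map (adj'.homEquiv _ _ (transposedMate adj e x)) ≫
      adj'.counit.app (L'.obj (F.obj x)) = transposedMate adj e x :=
    (adj'.homEquiv_counit _ _ _).symm.trans (Equiv.symm_apply_apply _ _)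
  rw [← R'.map_comp, h, ← adj'.homEquiv_naturality_right]
  refine (adj'.homEquiv_naturality_left _ _).symm.trans (congrArg (adj'.homEquiv _ _) ?_)
  have h₁ := he (R.map (adj.counit.app (L.obj x)))
  have h₂ : G.map (L.map (R.map (adj.counit.app (L.obj x)))) ≫
      G.map (adj.counit.app (L.obj x)) =
      G.map (adj.counit.app (L.obj (R.obj (L.obj x)))) ≫ G.map (adj.counit.app (L.obj x)) := by
    rw [← G.map_comp, ← G.map_comp]
    exact congrArg G.map (adj.counit_naturality _)
  simp only [transposedMate, Category.assoc, Iso.inv_hom_id_assoc]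
  exact (reassoc_of% h₁) _ |>.trans (congrArg ((e _).hom ≫ ·) ((reassoc_of% h₂) _))

end Mate

/-- Given adjunctions `L ⊣ R` and `L' ⊣ R'` and functors `F, G` with `L ⋙ G = F ⋙ L'`,
the mate of the identity square, with components
`ν_a : F (R a) ⟶ R' (L' (F (R a))) = R' (G (L (R a))) ⟶ R' (G a)`, yields at `a = L x` a
colax monad morphism from the monad `R ∘ L` to the monad `R' ∘ L'` over `F`.
(Lemma 4.3 of the paper, specialized to the identity 2-monad on Cat.) -/
theorem mate_isColaxMonadMorphism
    {X : Type u₁} [Category.{v₁} X] {A : Type u₂} [Category.{v₂} A]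
    {X' : Type u₃} [Category.{v₃} X'] {A' : Type u₄} [Category.{v₄} A']
    (L : X ⥤ A) (R : A ⥤ X) (adj : L ⊣ R)
    (L' : X' ⥤ A') (R' : A' ⥤ X') (adj' : L' ⊣ R')
    (F : X ⥤ X') (G : A ⥤ A') (hcomm : L ⋙ G = F ⋙ L')
    (φ : (adj.toMonad).toFunctor ⋙ F ⟶ F ⋙ (adj'.toMonad).toFunctor)
    (hφ : ∀ x : X, φ.app x =
      (adj'.unit.app (F.obj (R.obj (L.obj x))) ≫
        R'.map (eqToHom (Functor.congr_obj hcomm.symm (R.obj (L.obj x))) ≫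
          G.map (adj.counit.app (L.obj x)))) ≫
      eqToHom (congrArg R'.obj (Functor.congr_obj hcomm x))) :
    IsColaxMonadMorphism adj.toMonad adj'.toMonad F φ := by
  let e (x : X) : L'.obj (F.obj x) ≅ G.obj (L.obj x) :=
    eqToIso (Functor.congr_obj hcomm.symm x)
  have he {x y : X} (f : x ⟶ y) :
      L'.map (F.map f) ≫ (e y).hom = (e x).hom ≫ G.map (L.map f) := by
    simpa [e] using (eqToHom hcomm.symm).naturality f
  have hφ' (x : X) : φ.app x = adj'.homEquiv _ _ (transposedMate adj e x) := by
    rw [hφ, adj'.homEquiv_unit]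
    simp only [transposedMate, e, eqToIso.hom, eqToIso.inv, Functor.map_comp, eqToHom_map,
      Category.assoc]
    rfl
  refine ⟨fun x => ?_, fun x => ?_⟩
  · rw [hφ']
    exact map_unit_comp_transposedMate adj adj' e he x
  · rw [hφ', hφ']
    exact map_counit_comp_transposedMate adj adj' e he x
end

section
/- Let (T, η^T, μ^T) and (S, η^S, μ^S) be monads on a category C and let γ be a natural transformation with components γ_X : S (T X) ⟶ T (S X). Then γ is a distributive law of S over T (i.e. satisfies axioms (1)–(4)) if and only if the composite data TS_γ — the endofunctor X ↦ T (S X) together with unit η^T_{S X} ∘ η^S_X and multiplication μ^T_{S X} ∘ T (T (μ^S_X)) ∘ T (γ_{S X}) : T S T S X ⟶ T S X — satisfies the monad axioms, i.e. defines a monad on C. (Beck's characterization, Theorem 3.8 (i) ⇔ (iv) of the paper, for K = Cat.) -/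
open CategoryTheory

universe v u

variable {C : Type u} [Category.{v} C]

/-- A distributive law of the monad `S` over the monad `T` on `C`: a natural transformation `γ`
with components `γ_X : S (T X) ⟶ T (S X)` satisfying
(1) `γ_X ∘ S (η^T_X) = η^T_{S X}`;
(2) `γ_X ∘ η^S_{T X} = T (η^S_X)`;
(3) `γ_X ∘ S (μ^T_X) = μ^T_{S X} ∘ T (γ_X) ∘ γ_{T X}`;
(4) `γ_X ∘ μ^S_{T X} = T (μ^S_X) ∘ γ_{S X} ∘ S (γ_X)`. -/
def IsDistributiveLaw (T S : Monad C)
    (γ : T.toFunctor ⋙ S.toFunctor ⟶ S.toFunctor ⋙ T.toFunctor) : Prop :=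
  (∀ X : C, S.map (T.η.app X) ≫ γ.app X = T.η.app (S.obj X)) ∧
  (∀ X : C, S.η.app (T.obj X) ≫ γ.app X = T.map (S.η.app X)) ∧
  (∀ X : C, S.map (T.μ.app X) ≫ γ.app X =
      γ.app (T.obj X) ≫ T.map (γ.app X) ≫ T.μ.app (S.obj X)) ∧
  (∀ X : C, S.μ.app (T.obj X) ≫ γ.app X =
      S.map (γ.app X) ≫ γ.app (S.obj X) ≫ T.map (S.μ.app X))

/-- The monad axioms for the data of an endofunctor `P` together with families of morphisms
`η_X : X ⟶ P X` and `μ_X : P (P X) ⟶ P X`: naturality of `η` and `μ`, the two unit laws and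
associativity; i.e. the data defines a monad on `C`. -/
def IsMonadStructure (P : C ⥤ C) (η : ∀ X : C, X ⟶ P.obj X)
    (μ : ∀ X : C, P.obj (P.obj X) ⟶ P.obj X) : Prop :=
  (∀ {X Y : C} (f : X ⟶ Y), f ≫ η Y = η X ≫ P.map f) ∧
  (∀ {X Y : C} (f : X ⟶ Y), P.map (P.map f) ≫ μ Y = μ X ≫ P.map f) ∧
  (∀ X : C, η (P.obj X) ≫ μ X = 𝟙 (P.obj X)) ∧
  (∀ X : C, P.map (η X) ≫ μ X = 𝟙 (P.obj X)) ∧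
  (∀ X : C, P.map (μ X) ≫ μ X = μ (P.obj X) ≫ μ X)

namespace CategoryTheory.Monad

variable {T S : Monad C} (γ : T.toFunctor ⋙ S.toFunctor ⟶ S.toFunctor ⋙ T.toFunctor)

lemma exchange_naturality {X Y : C} (f : X ⟶ Y) :
    S.map (T.map f) ≫ γ.app Y = γ.app X ≫ T.map (S.map f) :=
  γ.naturality f

/-- The action `S T S X ⟶ T S X` of `S` on `T S X` induced by `γ`. -/
def exchangeAction (X : C) : S.obj (T.obj (S.obj X)) ⟶ T.obj (S.obj X) :=
  γ.app (S.obj X) ≫ T.map (S.μ.app X)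

lemma map_map_η_exchangeAction (X : C) :
    S.map (T.map (S.η.app X)) ≫ exchangeAction γ X = γ.app X := by
  rw [exchangeAction, reassoc_of% exchange_naturality γ, ← T.map_comp, S.right_unit, T.map_id]
  exact Category.comp_id _

lemma exchangeAction_naturality {X Y : C} (f : X ⟶ Y) :
    S.map (T.map (S.map f)) ≫ exchangeAction γ Y = exchangeAction γ X ≫ T.map (S.map f) := by
  have h : S.map (S.map f) ≫ S.μ.app Y = S.μ.app X ≫ S.map f := S.μ.naturality f
  rw [exchangeAction, reassoc_of% exchange_naturality γ, ← T.map_comp, h, T.map_comp,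
    exchangeAction, Category.assoc]

lemma η_comp_map_comp_μ {X Y : C} (f : X ⟶ T.obj Y) :
    T.η.app X ≫ T.map f ≫ T.μ.app Y = f := by
  have h : f ≫ T.η.app (T.obj Y) = T.η.app X ≫ T.map f := T.η.naturality f
  rw [← reassoc_of% h, T.left_unit]
  exact Category.comp_id _

lemma map_comp_μ_injective {X Y : C} {f g : X ⟶ T.obj Y}
    (h : T.map f ≫ T.μ.app Y = T.map g ≫ T.μ.app Y) : f = g := by
  rw [← η_comp_map_comp_μ f, h, η_comp_map_comp_μ]

lemma map_comp_μ_comp_map_comp_μ {X Y Z : C} (f : X ⟶ T.obj Y) (g : Y ⟶ T.obj Z) :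
    (T.map f ≫ T.μ.app Y) ≫ T.map g ≫ T.μ.app Z =
      T.map (f ≫ T.map g ≫ T.μ.app Z) ≫ T.μ.app Z := by
  have h : T.map (T.map g) ≫ T.μ.app (T.obj Z) = T.μ.app Y ≫ T.map g := T.μ.naturality g
  have h' : T.map (T.μ.app Z) ≫ T.μ.app Z = T.μ.app (T.obj Z) ≫ T.μ.app Z := T.assoc Z
  simp only [T.map_comp, Category.assoc]
  rw [h', reassoc_of% h]

lemma exchange_η_left_iff :
    (∀ X : C, S.map (T.η.app X) ≫ γ.app X = T.η.app (S.obj X)) ↔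
      ∀ X : C, S.map (S.η.app X ≫ T.η.app (S.obj X)) ≫ exchangeAction γ X =
        T.η.app (S.obj X) := by
  refine forall_congr' fun X => ?_
  have h : S.η.app X ≫ T.η.app (S.obj X) = T.η.app X ≫ T.map (S.η.app X) :=
    T.η.naturality (S.η.app X)
  rw [h, S.map_comp, Category.assoc, map_map_η_exchangeAction]

lemma exchange_η_right_iff :
    (∀ X : C, S.η.app (T.obj X) ≫ γ.app X = T.map (S.η.app X)) ↔
      ∀ X : C, S.η.app (T.obj (S.obj X)) ≫ exchangeAction γ X = 𝟙 (T.obj (S.obj X)) := by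
  refine ⟨fun h X => ?_, fun h X => ?_⟩
  · rw [exchangeAction, reassoc_of% h (S.obj X), ← T.map_comp, S.left_unit]
    exact T.map_id _
  · have hη : T.map (S.η.app X) ≫ S.η.app (T.obj (S.obj X)) =
        S.η.app (T.obj X) ≫ S.map (T.map (S.η.app X)) := S.η.naturality (T.map (S.η.app X))
    rw [← map_map_η_exchangeAction, ← reassoc_of% hη, h, Category.comp_id]

lemma exchange_μ_left_iff :
    (∀ X : C, S.map (T.μ.app X) ≫ γ.app X =
      γ.app (T.obj X) ≫ T.map (γ.app X) ≫ T.μ.app (S.obj X)) ↔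
      ∀ X : C, S.map (T.μ.app (S.obj X)) ≫ exchangeAction γ X =
        γ.app (T.obj (S.obj X)) ≫ T.map (exchangeAction γ X) ≫ T.μ.app (S.obj X) := by
  refine ⟨fun h X => ?_, fun h X => ?_⟩
  · have hμ : T.map (T.map (S.μ.app X)) ≫ T.μ.app (S.obj X) =
        T.μ.app (S.obj (S.obj X)) ≫ T.map (S.μ.app X) := T.μ.naturality (S.μ.app X)
    rw [exchangeAction, reassoc_of% h (S.obj X), T.map_comp, Category.assoc, hμ]
  · have hμ : T.map (T.map (S.η.app X)) ≫ T.μ.app (S.obj X) =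
        T.μ.app X ≫ T.map (S.η.app X) := T.μ.naturality (S.η.app X)
    rw [← map_map_η_exchangeAction, ← S.map_comp_assoc, ← hμ, S.map_comp_assoc, h,
      reassoc_of% exchange_naturality γ, ← T.map_comp_assoc]
    rfl

lemma exchange_μ_right_iff :
    (∀ X : C, S.μ.app (T.obj X) ≫ γ.app X =
      S.map (γ.app X) ≫ γ.app (S.obj X) ≫ T.map (S.μ.app X)) ↔
      ∀ X : C, S.μ.app (T.obj (S.obj X)) ≫ exchangeAction γ X =
        S.map (exchangeAction γ X) ≫ exchangeAction γ X := by
  refine ⟨fun h X => ?_, fun h X => ?_⟩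
  · have hS : S.map (S.μ.app X) ≫ S.μ.app X = S.μ.app (S.obj X) ≫ S.μ.app X := S.assoc X
    rw [exchangeAction, reassoc_of% h (S.obj X), S.map_comp, Category.assoc,
      reassoc_of% exchange_naturality γ, ← T.map_comp, ← T.map_comp, hS]
  · have hμ : S.map (S.map (T.map (S.η.app X))) ≫ S.μ.app (T.obj (S.obj X)) =
        S.μ.app (T.obj X) ≫ S.map (T.map (S.η.app X)) := S.μ.naturality (T.map (S.η.app X))
    rw [← map_map_η_exchangeAction, ← reassoc_of% hμ, h, ← S.map_comp_assoc]
    rfl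

/-- Given the unit axioms, the two multiplication axioms for `γ` together amount to
associativity of the composite multiplication. -/
lemma exchange_μ_iff
    (h₁ : ∀ X : C, S.map (T.η.app X) ≫ γ.app X = T.η.app (S.obj X))
    (h₂ : ∀ X : C, S.η.app (T.obj X) ≫ γ.app X = T.map (S.η.app X)) :
    ((∀ X : C, S.map (T.μ.app X) ≫ γ.app X =
        γ.app (T.obj X) ≫ T.map (γ.app X) ≫ T.μ.app (S.obj X)) ∧
      (∀ X : C, S.μ.app (T.obj X) ≫ γ.app X =
        S.map (γ.app X) ≫ γ.app (S.obj X) ≫ T.map (S.μ.app X))) ↔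
      ∀ X : C, S.map (T.map (exchangeAction γ X) ≫ T.μ.app (S.obj X)) ≫ exchangeAction γ X =
        exchangeAction γ (T.obj (S.obj X)) ≫ T.map (exchangeAction γ X) ≫
          T.μ.app (S.obj X) := by
  rw [exchange_μ_left_iff, exchange_μ_right_iff]
  refine ⟨fun ⟨h₃, h₄⟩ X => ?_, fun h => ⟨fun X => ?_, fun X => ?_⟩⟩
  · rw [S.map_comp, Category.assoc, h₃, reassoc_of% exchange_naturality γ, ← T.map_comp_assoc, ← h₄,
      T.map_comp_assoc]
    simp only [exchangeAction, Category.assoc]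
  · have hη := (exchange_η_right_iff γ).1 h₂ X
    rw [← reassoc_of% map_map_η_exchangeAction γ, ← h, ← S.map_comp_assoc, ← T.map_comp_assoc, hη,
      T.map_id, Category.id_comp]
  · have hη : T.η.app (S.obj (S.obj (T.obj (S.obj X)))) ≫ T.map (S.μ.app (T.obj (S.obj X))) ≫
        T.map (exchangeAction γ X) ≫ T.μ.app (S.obj X) =
        S.μ.app (T.obj (S.obj X)) ≫ exchangeAction γ X := by
      rw [← T.map_comp_assoc]
      exact η_comp_map_comp_μ _
    have hk : S.map (exchangeAction γ X) = S.map (T.η.app (S.obj (T.obj (S.obj X)))) ≫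
        S.map (T.map (exchangeAction γ X) ≫ T.μ.app (S.obj X)) := by
      rw [← S.map_comp, η_comp_map_comp_μ]
    rw [hk, Category.assoc, h, ← hη, ← reassoc_of% h₁]
    simp only [exchangeAction, Category.assoc]

end CategoryTheory.Monad

/-- Beck's characterization (Theorem 3.8 (i) ⇔ (iv) of the paper, for `K = Cat`): a natural
transformation `γ` with components `S (T X) ⟶ T (S X)` is a distributive law of `S` over `T`
if and only if the composite data `TS_γ` — the endofunctor `X ↦ T (S X)` with unit
`η^T_{S X} ∘ η^S_X` and multiplication `μ^T_{S X} ∘ T (T (μ^S_X)) ∘ T (γ_{S X})` — defines a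
monad on `C`. -/
theorem isDistributiveLaw_iff_comp_isMonad (T S : Monad C)
    (γ : T.toFunctor ⋙ S.toFunctor ⟶ S.toFunctor ⋙ T.toFunctor) :
    IsDistributiveLaw T S γ ↔
      IsMonadStructure (S.toFunctor ⋙ T.toFunctor)
        (fun X => S.η.app X ≫ T.η.app (S.obj X))
        (fun X => T.map (γ.app (S.obj X)) ≫ T.map (T.map (S.μ.app X)) ≫
          T.μ.app (S.obj X)) := by
  have hμ (X : C) : T.map (γ.app (S.obj X)) ≫ T.map (T.map (S.μ.app X)) ≫ T.μ.app (S.obj X) =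
      T.map (Monad.exchangeAction γ X) ≫ T.μ.app (S.obj X) :=
    (T.map_comp_assoc _ _ _).symm
  simp only [hμ]
  constructor
  · rintro ⟨h₁, h₂, h₃₄⟩
    refine ⟨fun f => ?_, fun f => ?_, fun X => ?_, fun X => ?_, fun X => ?_⟩
    · have hS := S.η.naturality f
      have hT := T.η.naturality (S.map f)
      simp only [Functor.id_obj, Functor.id_map] at hS hT
      simp only [Functor.comp_map, Category.assoc]
      rw [← hT, reassoc_of% hS]
    · have hT : T.map (T.map (S.map f)) ≫ T.μ.app _ = T.μ.app _ ≫ T.map (S.map f) :=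
        T.μ.naturality (S.map f)
      simp only [Functor.comp_map, Category.assoc]
      rw [← hT, ← T.map_comp_assoc, ← T.map_comp_assoc, Monad.exchangeAction_naturality]
    · dsimp
      rw [Category.assoc, Monad.η_comp_map_comp_μ]
      exact (Monad.exchange_η_right_iff γ).1 h₂ X
    · dsimp
      rw [← T.map_comp_assoc, (Monad.exchange_η_left_iff γ).1 h₁]
      exact T.right_unit _
    · dsimp
      rw [Monad.map_comp_μ_comp_map_comp_μ, ← T.map_comp_assoc]
      rw [(Monad.exchange_μ_iff γ h₁ h₂).1 h₃₄]
  · rintro ⟨-, -, hl, hr, ha⟩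
    have h₁ := (Monad.exchange_η_left_iff γ).2 fun X => Monad.map_comp_μ_injective <| by
      have := hr X
      dsimp at this
      rw [← T.map_comp_assoc] at this
      exact this.trans (T.right_unit _).symm
    have h₂ := (Monad.exchange_η_right_iff γ).2 fun X => by
      have := hl X
      dsimp at this
      rwa [Category.assoc, Monad.η_comp_map_comp_μ] at this
    refine ⟨h₁, h₂, (Monad.exchange_μ_iff γ h₁ h₂).2 fun X => Monad.map_comp_μ_injective ?_⟩
    have := ha X
    dsimp at this
    rwa [Monad.map_comp_μ_comp_map_comp_μ, ← T.map_comp_assoc] at this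
end

section
/- Let T be a monad on a category C, S a monad on a category D, and F : C ⥤ D a functor. There is a bijection between (a) lax monad morphisms λ from T to S over F, and (b) functors F̃ : T.Algebra ⥤ S.Algebra such that F̃ ⋙ U_S = U_T ⋙ F; under this bijection, F̃ sends a T-algebra (X, a) to the S-algebra (F X, F a ∘ λ_X). Moreover, given lax monad morphisms λ over F and κ over G with corresponding lifts F̃ and G̃, a natural transformation α : F ⟶ G satisfies κ_X ∘ S (α_X) = α_{T X} ∘ λ_X for all X if and only if there is a (necessarily unique) natural transformation ᾱ : F̃ ⟶ G̃ whose component at each T-algebra A is carried by U_S to α_{U_T A}. (This is the full-embedding content of Theorem 3.6 of the paper, for K = Cat: monads with lax morphisms embed fully into right adjoints via Eilenberg–Moore objects.) -/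
open CategoryTheory

universe v₁ v₂ u₁ u₂

variable {C : Type u₁} [Category.{v₁} C] {D : Type u₂} [Category.{v₂} D]

/-- A lax monad morphism from a monad `T` on `C` to a monad `S` on `D` over a functor
`F : C ⥤ D`: a natural transformation `l` with components `l_X : S (F X) ⟶ F (T X)` such that
`l_X ∘ η^S_{F X} = F (η^T_X)` and `l_X ∘ μ^S_{F X} = F (μ^T_X) ∘ l_{T X} ∘ S (l_X)`. -/
def IsLaxMonadMorphism (T : Monad C) (S : Monad D) (F : C ⥤ D)
    (l : F ⋙ S.toFunctor ⟶ T.toFunctor ⋙ F) : Prop :=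
  (∀ X : C, S.η.app (F.obj X) ≫ l.app X = F.map (T.η.app X)) ∧
  (∀ X : C, S.μ.app (F.obj X) ≫ l.app X =
      S.map (l.app X) ≫ l.app (T.obj X) ≫ F.map (T.μ.app X))

/-- The functor between Eilenberg–Moore categories over `F` determined by a natural family of
`S`-algebra structures on the objects underlying the values of `F` at `T`-algebras. -/
def algebraFunctorOfAction {T : Monad C} {S : Monad D} (F : C ⥤ D)
    (b : ∀ A : T.Algebra, S.obj (F.obj A.A) ⟶ F.obj A.A)
    (naturality : ∀ {A B : T.Algebra} (f : A ⟶ B),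
      S.map (F.map f.f) ≫ b B = b A ≫ F.map f.f)
    (unit : ∀ A, S.η.app (F.obj A.A) ≫ b A = 𝟙 (F.obj A.A))
    (assoc : ∀ A, S.μ.app (F.obj A.A) ≫ b A = S.map (b A) ≫ b A) :
    T.Algebra ⥤ S.Algebra where
  obj A := { A := F.obj A.A, a := b A, unit := unit A, assoc := assoc A }
  map f := { f := F.map f.f, h := naturality f }

/-- A functor into the Eilenberg–Moore category lying over `V` is determined by a natural family
of algebra structures on the values of `V`. -/
theorem exists_action_of_comp_forget_eq {E : Type*} [Category* E] (S : Monad D) {V : E ⥤ D}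
    (P : E ⥤ S.Algebra) (h : P ⋙ S.forget = V) :
    ∃ (b : ∀ A : E, S.obj (V.obj A) ⟶ V.obj A)
      (naturality : ∀ {A B : E} (f : A ⟶ B), S.map (V.map f) ≫ b B = b A ≫ V.map f)
      (unit : ∀ A, S.η.app (V.obj A) ≫ b A = 𝟙 (V.obj A))
      (assoc : ∀ A, S.μ.app (V.obj A) ≫ b A = S.map (b A) ≫ b A),
      P = { obj := fun A => { A := V.obj A, a := b A, unit := unit A, assoc := assoc A }
            map := fun f => { f := V.map f, h := naturality f }
            map_id := fun A => Monad.Algebra.Hom.ext (V.map_id A)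
            map_comp := fun f g => Monad.Algebra.Hom.ext (V.map_comp f g) } := by
  subst h
  exact ⟨fun A => (P.obj A).a, fun f => (P.map f).h,
    fun A => (P.obj A).unit, fun A => (P.obj A).assoc, rfl⟩

namespace IsLaxMonadMorphism

variable {T : Monad C} {S : Monad D} {F G : C ⥤ D}

/-- The functor between Eilenberg–Moore categories induced by a lax monad morphism. -/
def lift {l : F ⋙ S.toFunctor ⟶ T.toFunctor ⋙ F} (hl : IsLaxMonadMorphism T S F l) :
    T.Algebra ⥤ S.Algebra :=
  algebraFunctorOfAction F (fun A => l.app A.A ≫ F.map A.a)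
    (fun {A B} f => by
      have n := l.naturality f.f
      dsimp at n ⊢
      rw [reassoc_of% n, Category.assoc, ← F.map_comp, ← F.map_comp, f.h])
    (fun A => by
      have h := hl.1 A.A
      dsimp at h ⊢
      rw [reassoc_of% h, ← F.map_comp, A.unit, F.map_id])
    (fun A => by
      have h := hl.2 A.A
      have n := l.naturality A.a
      dsimp at h n ⊢
      rw [reassoc_of% h, ← F.map_comp, A.assoc, S.map_comp, Category.assoc, reassoc_of% n,
        F.map_comp])

theorem lift_comp_forget {l : F ⋙ S.toFunctor ⟶ T.toFunctor ⋙ F}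
    (hl : IsLaxMonadMorphism T S F l) : hl.lift ⋙ S.forget = T.forget ⋙ F :=
  rfl

/-- A natural transformation `l` is recovered from its action on free algebras. -/
theorem map_unit_comp_action_free (l : F ⋙ S.toFunctor ⟶ T.toFunctor ⋙ F) (X : C) :
    S.map (F.map (T.η.app X)) ≫ l.app (T.obj X) ≫ F.map (T.μ.app X) = l.app X := by
  have n := l.naturality (T.η.app X)
  dsimp at n
  rw [reassoc_of% n, ← F.map_comp, T.right_unit]
  simp

theorem eq_of_lift_eq {l l' : F ⋙ S.toFunctor ⟶ T.toFunctor ⋙ F}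
    (hl : IsLaxMonadMorphism T S F l) (hl' : IsLaxMonadMorphism T S F l')
    (h : hl.lift = hl'.lift) : l = l' := by
  ext X
  have hX : l.app (T.obj X) ≫ F.map (T.μ.app X) = l'.app (T.obj X) ≫ F.map (T.μ.app X) :=
    eq_of_heq (Monad.Algebra.mk.inj (Functor.congr_obj h (T.free.obj X))).2
  rw [← map_unit_comp_action_free l, hX, map_unit_comp_action_free]

theorem exists_lift_eq (P : T.Algebra ⥤ S.Algebra) (h : P ⋙ S.forget = T.forget ⋙ F) :
    ∃ (l : F ⋙ S.toFunctor ⟶ T.toFunctor ⋙ F) (hl : IsLaxMonadMorphism T S F l),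
      hl.lift = P := by
  obtain ⟨b, naturality, unit, assoc, rfl⟩ :
      ∃ (b : ∀ A : T.Algebra, S.obj (F.obj A.A) ⟶ F.obj A.A)
        (naturality : ∀ {A B : T.Algebra} (f : A ⟶ B),
          S.map (F.map f.f) ≫ b B = b A ≫ F.map f.f)
        (unit : ∀ A, S.η.app (F.obj A.A) ≫ b A = 𝟙 (F.obj A.A))
        (assoc : ∀ A, S.μ.app (F.obj A.A) ≫ b A = S.map (b A) ≫ b A),
        P = algebraFunctorOfAction F b naturality unit assoc :=
    exists_action_of_comp_forget_eq S P h
  obtain ⟨d, d_nat, d_unit, d_assoc, d_eq, hd⟩ :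
      ∃ d : ∀ X : C, S.obj (F.obj (T.obj X)) ⟶ F.obj (T.obj X),
        (∀ {X Y : C} (f : X ⟶ Y), S.map (F.map (T.map f)) ≫ d Y = d X ≫ F.map (T.map f)) ∧
        (∀ X, S.η.app (F.obj (T.obj X)) ≫ d X = 𝟙 (F.obj (T.obj X))) ∧
        (∀ X, S.μ.app (F.obj (T.obj X)) ≫ d X = S.map (d X) ≫ d X) ∧
        (∀ X, d X = b (T.free.obj X)) ∧
        ∀ A : T.Algebra, S.map (F.map (T.η.app A.A)) ≫ d A.A ≫ F.map A.a = b A := by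
    refine ⟨fun X => b (T.free.obj X), fun f => naturality (T.free.map f),
      fun X => unit (T.free.obj X), fun X => assoc (T.free.obj X), fun _ => rfl, fun A => ?_⟩
    have n : S.map (F.map A.a) ≫ b A = b (T.free.obj A.A) ≫ F.map A.a :=
      naturality (A := T.free.obj A.A) { f := A.a, h := A.assoc.symm }
    refine (congrArg (S.map (F.map (T.η.app A.A)) ≫ ·) n.symm).trans ?_
    have e : F.map (T.η.app A.A) ≫ F.map A.a = 𝟙 (F.obj A.A) := by
      rw [← F.map_comp, A.unit]
      exact F.map_id A.A
    dsimp at e ⊢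
    rw [← S.map_comp_assoc, e, S.map_id, Category.id_comp]
  let l : F ⋙ S.toFunctor ⟶ T.toFunctor ⋙ F :=
    { app := fun X => S.map (F.map (T.η.app X)) ≫ d X
      naturality := fun X Y f => by
        have e := T.η.naturality f
        dsimp at e ⊢
        rw [Category.assoc, ← d_nat, ← S.map_comp_assoc, ← S.map_comp_assoc, ← F.map_comp,
          ← F.map_comp, e] }
  have hb : ∀ A : T.Algebra, l.app A.A ≫ F.map A.a = b A := fun A =>
    (Category.assoc _ _ _).trans (hd A)
  have hf : ∀ X, l.app (T.obj X) ≫ F.map (T.μ.app X) = d X := fun X =>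
    (hb (T.free.obj X)).trans (d_eq X).symm
  have hl : IsLaxMonadMorphism T S F l := by
    refine ⟨fun X => ?_, fun X => ?_⟩
    · have n := S.η.naturality (F.map (T.η.app X))
      dsimp [l] at n ⊢
      rw [← reassoc_of% n, d_unit, Category.comp_id]
    · have n := S.μ.naturality (F.map (T.η.app X))
      dsimp at n
      rw [hf]
      dsimp [l]
      rw [← reassoc_of% n, d_assoc, S.map_comp, Category.assoc]
  refine ⟨l, hl, ?_⟩
  unfold lift
  congr 1
  exact funext hb

/-- Lax monad morphisms over `F` correspond to lifts of `F` to Eilenberg–Moore categories. -/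
noncomputable def equivLifts (T : Monad C) (S : Monad D) (F : C ⥤ D) :
    {l : F ⋙ S.toFunctor ⟶ T.toFunctor ⋙ F // IsLaxMonadMorphism T S F l} ≃
      {P : T.Algebra ⥤ S.Algebra // P ⋙ S.forget = T.forget ⋙ F} :=
  Equiv.ofBijective (fun l => ⟨l.2.lift, l.2.lift_comp_forget⟩)
    ⟨fun l l' h => Subtype.ext (eq_of_lift_eq l.2 l'.2 (congrArg Subtype.val h)),
      fun P => by
        obtain ⟨l, hl, h⟩ := exists_lift_eq P.1 P.2
        exact ⟨⟨l, hl⟩, Subtype.ext h⟩⟩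

/-- A natural transformation is compatible with `l` and `k` if and only if its components at
algebras are algebra morphisms between the lifts. -/
theorem compatible_iff_forall_algebra (l : F ⋙ S.toFunctor ⟶ T.toFunctor ⋙ F)
    (k : G ⋙ S.toFunctor ⟶ T.toFunctor ⋙ G) (α : F ⟶ G) :
    (∀ X : C, S.map (α.app X) ≫ k.app X = l.app X ≫ α.app (T.obj X)) ↔
      ∀ A : T.Algebra, S.map (α.app A.A) ≫ k.app A.A ≫ G.map A.a =
        (l.app A.A ≫ F.map A.a) ≫ α.app A.A := by
  refine ⟨fun h A => ?_, fun h X => ?_⟩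
  · rw [reassoc_of% h A.A, Category.assoc, α.naturality]
  · have hX : S.map (α.app (T.obj X)) ≫ k.app (T.obj X) ≫ G.map (T.μ.app X) =
        (l.app (T.obj X) ≫ F.map (T.μ.app X)) ≫ α.app (T.obj X) := h (T.free.obj X)
    rw [← map_unit_comp_action_free k, ← S.map_comp_assoc, ← α.naturality, S.map_comp_assoc, hX]
    simpa only [Category.assoc] using
      congrArg (· ≫ α.app (T.obj X)) (map_unit_comp_action_free l X)

/-- A natural transformation is compatible with `l` and `k` if and only if it lifts to the
induced functors between Eilenberg–Moore categories. -/
theorem compatible_iff_existsUnique_lift {l : F ⋙ S.toFunctor ⟶ T.toFunctor ⋙ F}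
    {k : G ⋙ S.toFunctor ⟶ T.toFunctor ⋙ G} (hl : IsLaxMonadMorphism T S F l)
    (hk : IsLaxMonadMorphism T S G k) (α : F ⟶ G) :
    (∀ X : C, S.map (α.app X) ≫ k.app X = l.app X ≫ α.app (T.obj X)) ↔
      ∃! β : hl.lift ⟶ hk.lift, ∀ A : T.Algebra, (β.app A).f = α.app A.A := by
  rw [compatible_iff_forall_algebra]
  refine ⟨fun h => ?_, fun ⟨β, hβ, _⟩ A => ?_⟩
  · refine ⟨{ app := fun A => { f := α.app A.A, h := h A }, naturality := fun A B f => ?_ },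
      fun _ => rfl, fun β hβ => ?_⟩
    · ext
      exact α.naturality f.f
    · ext A
      exact hβ A
  · rw [← hβ A]
    exact (β.app A).h

end IsLaxMonadMorphism

/-- For monads `T` on `C` and `S` on `D`, there is (for each functor `F : C ⥤ D`) a bijection
between lax monad morphisms from `T` to `S` over `F` and functors `F̃ : T.Algebra ⥤ S.Algebra`
with `F̃ ⋙ U_S = U_T ⋙ F`; under this bijection `F̃` sends a `T`-algebra `(X, a)` to the
`S`-algebra `(F X, F a ∘ l_X)`.  Moreover, given lax monad morphisms `l` over `F` and `k` over
`G` with corresponding lifts `F̃` and `G̃`, a natural transformation `α : F ⟶ G` satisfies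
`k_X ∘ S (α_X) = α_{T X} ∘ l_X` for all `X` if and only if there is a (necessarily unique)
natural transformation `ᾱ : F̃ ⟶ G̃` whose component at each `T`-algebra `A` is carried by
`U_S` to `α_{U_T A}`. (The full-embedding content of Theorem 3.6 of the paper, for `K = Cat`.) -/
theorem laxMonadMorphisms_equiv_algebraLifts (T : Monad C) (S : Monad D) :
    ∃ e : ∀ F : C ⥤ D,
      {l : F ⋙ S.toFunctor ⟶ T.toFunctor ⋙ F // IsLaxMonadMorphism T S F l} ≃
      {F' : T.Algebra ⥤ S.Algebra // F' ⋙ S.forget = T.forget ⋙ F},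
      (∀ (F : C ⥤ D)
          (l : {l : F ⋙ S.toFunctor ⟶ T.toFunctor ⋙ F // IsLaxMonadMorphism T S F l})
          (A : T.Algebra),
        ((e F l).val.obj A).a =
          eqToHom (congrArg S.toFunctor.obj (Functor.congr_obj (e F l).property A)) ≫
            l.val.app A.A ≫ F.map A.a ≫
            eqToHom (Functor.congr_obj (e F l).property A).symm) ∧
      (∀ (F G : C ⥤ D)
          (l : {l : F ⋙ S.toFunctor ⟶ T.toFunctor ⋙ F // IsLaxMonadMorphism T S F l})
          (k : {k : G ⋙ S.toFunctor ⟶ T.toFunctor ⋙ G // IsLaxMonadMorphism T S G k})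
          (α : F ⟶ G),
        (∀ X : C, S.map (α.app X) ≫ k.val.app X = l.val.app X ≫ α.app (T.obj X)) ↔
          (∃! ᾱ : (e F l).val ⟶ (e G k).val, ∀ A : T.Algebra,
            S.forget.map (ᾱ.app A) =
              eqToHom (Functor.congr_obj (e F l).property A) ≫ α.app A.A ≫
                eqToHom (Functor.congr_obj (e G k).property A).symm)) := by
  refine ⟨IsLaxMonadMorphism.equivLifts T S, fun F l A => ?_, fun F G l k α => ?_⟩
  · have h : l.val.app A.A ≫ F.map A.a = 𝟙 _ ≫ l.val.app A.A ≫ F.map A.a ≫ 𝟙 _ := by simp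
    exact h
  · rw [l.2.compatible_iff_existsUnique_lift k.2]
    refine existsUnique_congr fun β => forall_congr' fun A => ?_
    have h : α.app A.A = 𝟙 _ ≫ α.app A.A ≫ 𝟙 _ := by simp
    exact ⟨fun e => e.trans h, fun e => e.trans h.symm⟩
end

section
/- Let (T, η, μ) be a monad and (W, ε, δ) a comonad on a category C. There is a bijection between (a) mixed distributive laws γ of the monad T over the comonad W, and (b) comonads (W̄, ε̄, δ̄) on the Eilenberg–Moore category T.Algebra lifting W, i.e. such that W̄ ⋙ U_T = U_T ⋙ W as functors T.Algebra ⥤ C and the whiskerings of ε̄ and δ̄ with U_T equal (modulo this equality of functors) the whiskerings of ε and δ with U_T; under this bijection, W̄ sends a T-algebra (X, a) to the carrier W X with T-action W a ∘ γ_X. (Proposition 3.13 of the paper identifies mixed distributive laws with comonads in mnd_l(K); for K = Cat, via the Eilenberg–Moore embedding this is the stated bijection.) -/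
open CategoryTheory

universe v u

variable {C : Type u} [Category.{v} C]

/-- A mixed distributive law of the monad `(T, η, μ)` over the comonad `(W, ε, δ)` on `C`:
a natural transformation `γ` with components `γ_X : T (W X) ⟶ W (T X)` satisfying
`γ_X ∘ η_{W X} = W (η_X)`, `γ_X ∘ μ_{W X} = W (μ_X) ∘ γ_{T X} ∘ T (γ_X)`,
`ε_{T X} ∘ γ_X = T (ε_X)` and `δ_{T X} ∘ γ_X = W (γ_X) ∘ γ_{W X} ∘ T (δ_X)`. -/
def IsMixedDistributiveLaw (T : Monad C) (W : Comonad C)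
    (γ : W.toFunctor ⋙ T.toFunctor ⟶ T.toFunctor ⋙ W.toFunctor) : Prop :=
  (∀ X : C, T.η.app (W.obj X) ≫ γ.app X = W.map (T.η.app X)) ∧
  (∀ X : C, T.μ.app (W.obj X) ≫ γ.app X =
      T.map (γ.app X) ≫ γ.app (T.obj X) ≫ W.map (T.μ.app X)) ∧
  (∀ X : C, γ.app X ≫ W.ε.app (T.obj X) = T.map (W.ε.app X)) ∧
  (∀ X : C, γ.app X ≫ W.δ.app (T.obj X) =
      T.map (W.δ.app X) ≫ γ.app (W.obj X) ≫ W.map (γ.app X))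

/-- A comonad `W'` on the Eilenberg–Moore category `T.Algebra` is a lift of the comonad `W` on
`C` if `W' ⋙ U_T = U_T ⋙ W` as functors `T.Algebra ⥤ C` and the whiskerings of `ε'` and `δ'`
with `U_T` equal (modulo this equality of functors) the whiskerings of `ε` and `δ` with
`U_T`. -/
def IsComonadLift (T : Monad C) (W : Comonad C) (W' : Comonad T.Algebra) : Prop :=
  ∃ h : W'.toFunctor ⋙ T.forget = T.forget ⋙ W.toFunctor,
    (∀ A : T.Algebra, T.forget.map (W'.ε.app A) =
        eqToHom (Functor.congr_obj h A) ≫ W.ε.app (T.forget.obj A)) ∧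
    (∀ A : T.Algebra, T.forget.map (W'.δ.app A) =
        eqToHom (Functor.congr_obj h A) ≫ W.δ.app (T.forget.obj A) ≫
          eqToHom ((Functor.congr_obj h (W'.obj A)).trans
            (congrArg W.toFunctor.obj (Functor.congr_obj h A))).symm)

namespace CategoryTheory

namespace Monad.Algebra

variable {T : Monad C}

@[simp]
lemma eqToHom_f {A B : T.Algebra} (h : A = B) :
    (eqToHom h).f = eqToHom (congrArg Algebra.A h) := by
  subst h
  rfl

lemma ext_of_eqToHom {A B : T.Algebra} (hA : A.A = B.A)
    (ha : A.a = T.map (eqToHom hA) ≫ B.a ≫ eqToHom hA.symm) : A = B := by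
  obtain ⟨X, a, _, _⟩ := A
  obtain ⟨Y, b, _, _⟩ := B
  obtain rfl : X = Y := hA
  obtain rfl : a = b := by simpa using ha
  rfl

/-- The algebra structure transported along an equality of carriers. -/
abbrev copy (A : T.Algebra) (X : C) (h : A.A = X) : T.Algebra where
  A := X
  a := T.map (eqToHom h.symm) ≫ A.a ≫ eqToHom h
  unit := by
    subst h
    simpa using A.unit
  assoc := by
    subst h
    simpa using A.assoc

lemma copy_eq (A : T.Algebra) (X : C) (h : A.A = X) : A.copy X h = A := by
  subst h
  exact ext_of_eqToHom rfl rfl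

lemma copy_h {A B : T.Algebra} (f : A ⟶ B) {X Y : C} (hA : A.A = X) (hB : B.A = Y)
    (g : X ⟶ Y) (hg : f.f = eqToHom hA ≫ g ≫ eqToHom hB.symm) :
    T.map g ≫ (B.copy Y hB).a = (A.copy X hA).a ≫ g := by
  subst hA hB
  obtain rfl : f.f = g := by simpa using hg
  simp

end Monad.Algebra

lemma Comonad.ext_of_eqToHom {D : Type*} [Category* D] {G H : Comonad D}
    (h : G.toFunctor = H.toFunctor)
    (hε : ∀ X, G.ε.app X = eqToHom (Functor.congr_obj h X) ≫ H.ε.app X)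
    (hδ : ∀ X, G.δ.app X = eqToHom (Functor.congr_obj h X) ≫ H.δ.app X ≫
      eqToHom (Functor.congr_obj (congrArg (fun F => F ⋙ F) h) X).symm) : G = H := by
  obtain ⟨F, ε, δ, _, _, _⟩ := G
  obtain ⟨F', ε', δ', _, _, _⟩ := H
  obtain rfl : F = F' := h
  obtain rfl : ε = ε' := by
    ext X
    simpa using hε X
  obtain rfl : δ = δ' := by
    ext X
    simpa using hδ X
  rfl

end CategoryTheory

/-- Algebra structures `T (W X) ⟶ W X`, one for each `T`-algebra with carrier `X`, for which `W`
sends algebra morphisms to algebra morphisms, and the counit and comultiplication of `W` are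
algebra morphisms. -/
@[ext]
structure LiftedAction (T : Monad C) (W : Comonad C) where
  /-- The action on `W.obj A.A`. -/
  act (A : T.Algebra) : T.obj (W.obj A.A) ⟶ W.obj A.A
  unit (A : T.Algebra) : T.η.app (W.obj A.A) ≫ act A = 𝟙 (W.obj A.A)
  assoc (A : T.Algebra) : T.μ.app (W.obj A.A) ≫ act A = T.map (act A) ≫ act A
  map {A B : T.Algebra} (f : A ⟶ B) :
    T.map (W.map f.f) ≫ act B = act A ≫ W.map f.f
  counit (A : T.Algebra) : T.map (W.ε.app A.A) ≫ A.a = act A ≫ W.ε.app A.A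
  comult (A : T.Algebra) :
    T.map (W.δ.app A.A) ≫ act ⟨W.obj A.A, act A, unit A, assoc A⟩ = act A ≫ W.δ.app A.A

namespace LiftedAction

variable {T : Monad C} {W : Comonad C} (L : LiftedAction T W)

/-- The algebra on `W.obj A.A` given by a lifted action. -/
abbrev alg (A : T.Algebra) : T.Algebra := ⟨W.obj A.A, L.act A, L.unit A, L.assoc A⟩

/-- The comonad on the Eilenberg–Moore category given by a lifted action. -/
def comonad : Comonad T.Algebra where
  obj := L.alg
  map f := { f := W.map f.f, h := L.map f }
  ε :=
    { app A := { f := W.ε.app A.A, h := L.counit A }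
      naturality _ _ f := Monad.Algebra.Hom.ext (W.ε.naturality f.f) }
  δ :=
    { app A := { f := W.δ.app A.A, h := L.comult A }
      naturality _ _ f := Monad.Algebra.Hom.ext (W.δ.naturality f.f) }

lemma isComonadLift_comonad : IsComonadLift T W L.comonad :=
  ⟨rfl, fun _ => (Category.id_comp _).symm,
    fun _ => ((Category.id_comp _).trans (Category.comp_id _)).symm⟩

lemma comonad_injective :
    Function.Injective (comonad : LiftedAction T W → Comonad T.Algebra) := by
  intro L L' h
  ext A
  have hA : L.alg A = L'.alg A := Functor.congr_obj (congrArg Comonad.toFunctor h) A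
  exact eq_of_heq (Monad.Algebra.mk.inj hA).2

lemma exists_comonad_eq {W' : Comonad T.Algebra} (hW' : IsComonadLift T W W') :
    ∃ L : LiftedAction T W, L.comonad = W' := by
  obtain ⟨h, hε, hδ⟩ := hW'
  have hobj (A : T.Algebra) : (W'.obj A).A = W.obj A.A := Functor.congr_obj h A
  have hmap {A B : T.Algebra} (f : A ⟶ B) : (W'.map f).f =
      eqToHom (hobj A) ≫ W.map f.f ≫ eqToHom (hobj B).symm := Functor.congr_hom h f
  have hcopy (A : T.Algebra) : (W'.obj A).copy _ (hobj A) = W'.obj A :=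
    (W'.obj A).copy_eq _ _
  have hε (A : T.Algebra) : (W'.ε.app A).f = eqToHom (hobj A) ≫ W.ε.app A.A := hε A
  have hδ (A : T.Algebra) : (W'.δ.app A).f = eqToHom (hobj A) ≫ W.δ.app A.A ≫
      eqToHom ((hobj (W'.obj A)).trans (congrArg W.obj (hobj A))).symm := hδ A
  let L : LiftedAction T W :=
    { act A := ((W'.obj A).copy _ (hobj A)).a
      unit A := ((W'.obj A).copy _ (hobj A)).unit
      assoc A := ((W'.obj A).copy _ (hobj A)).assoc
      map f := Monad.Algebra.copy_h (W'.map f) _ _ _ (hmap f)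
      counit A := by
        have := Monad.Algebra.copy_h (W'.ε.app A) (hobj A) rfl (W.ε.app A.A)
          ((hε A).trans (congrArg _ (Category.comp_id _).symm))
        simpa using this
      comult A :=
        Monad.Algebra.copy_h (W'.δ.app A ≫ eqToHom (congrArg W'.obj (hcopy A)).symm)
          (hobj A) (hobj _) (W.δ.app A.A) (by simp [hδ]) }
  have hL : L.comonad.toFunctor = W'.toFunctor :=
    CategoryTheory.Functor.ext hcopy fun A B f => by
      apply Monad.Algebra.Hom.ext
      change W.map f.f = (eqToHom (hcopy A) ≫ W'.map f ≫ eqToHom (hcopy B).symm).f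
      simp [hmap]
  refine ⟨L, Comonad.ext_of_eqToHom hL (fun A => ?_) fun A => ?_⟩
  · apply Monad.Algebra.Hom.ext
    change W.ε.app A.A = (eqToHom (hcopy A) ≫ W'.ε.app A).f
    simp [hε]
  · apply Monad.Algebra.Hom.ext
    change W.δ.app A.A = (eqToHom (hcopy A) ≫ W'.δ.app A ≫ eqToHom
      ((congrArg W'.obj (hcopy A)).symm.trans (hcopy ((W'.obj A).copy _ (hobj A))).symm)).f
    simp [hδ]

/-- Lifted actions are the same as comonads on the Eilenberg–Moore category lifting `W`. -/
noncomputable def equivComonadLift :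
    LiftedAction T W ≃ {W' : Comonad T.Algebra // IsComonadLift T W W'} :=
  Equiv.ofBijective (fun L => ⟨L.comonad, L.isComonadLift_comonad⟩)
    ⟨fun _ _ h => comonad_injective (congrArg Subtype.val h), fun W' =>
      (exists_comonad_eq W'.2).imp fun _ h => Subtype.ext h⟩

/-- The lifted action `W a ∘ γ_X` associated to a mixed distributive law `γ`. -/
@[simps]
def ofLaw (γ : W.toFunctor ⋙ T.toFunctor ⟶ T.toFunctor ⋙ W.toFunctor)
    (hγ : IsMixedDistributiveLaw T W γ) : LiftedAction T W where
  act A := γ.app A.A ≫ W.map A.a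
  unit A := by
    rw [← Category.assoc, hγ.1, ← W.map_comp, A.unit]
    exact W.map_id _
  assoc A := by
    have := γ.naturality A.a
    dsimp at this
    rw [← Category.assoc, hγ.2.1]
    simp only [Category.assoc, Functor.map_comp, reassoc_of% this]
    rw [← W.map_comp, A.assoc, W.map_comp]
  map {A B} f := by
    have := γ.naturality f.f
    dsimp at this
    rw [reassoc_of% this, ← W.map_comp, f.h, W.map_comp, Category.assoc]
  counit A := by
    rw [Category.assoc, W.counit_naturality, ← Category.assoc, hγ.2.2.1]
  comult A := by
    dsimp only
    rw [Category.assoc, W.delta_naturality, ← Category.assoc (γ.app A.A), hγ.2.2.2]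
    simp

/-- The free algebra, with carrier reducibly equal to `T.obj X`. -/
abbrev freeAlg (T : Monad C) (X : C) : T.Algebra :=
  ⟨T.obj X, T.μ.app X, T.left_unit X, (T.assoc X).symm⟩

lemma map_act_freeAlg {X Y : C} (f : X ⟶ Y) :
    T.map (W.map (T.map f)) ≫ L.act (freeAlg T Y) = L.act (freeAlg T X) ≫ W.map (T.map f) :=
  L.map (T.free.map f)

lemma map_act_a (A : T.Algebra) :
    T.map (W.map A.a) ≫ L.act A = L.act (freeAlg T A.A) ≫ W.map A.a :=
  L.map (A := freeAlg T A.A) ⟨A.a, A.assoc.symm⟩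

/-- The natural transformation `T W ⟶ W T` associated to a lifted action. -/
@[simps]
def law : W.toFunctor ⋙ T.toFunctor ⟶ T.toFunctor ⋙ W.toFunctor where
  app X := T.map (W.map (T.η.app X)) ≫ L.act (freeAlg T X)
  naturality X Y f := by
    dsimp
    rw [Category.assoc, ← map_act_freeAlg]
    simp only [← T.map_comp_assoc, ← W.map_comp, T.unit_naturality]

lemma law_comp (A : T.Algebra) : L.law.app A.A ≫ W.map A.a = L.act A := by
  rw [law_app, Category.assoc, ← map_act_a, ← T.map_comp_assoc, ← W.map_comp, A.unit]
  simp

lemma isMixedDistributiveLaw_law : IsMixedDistributiveLaw T W L.law := by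
  refine ⟨fun X => ?_, fun X => ?_, fun X => ?_, fun X => ?_⟩
  · rw [law_app]
    exact (T.η.naturality_assoc (W.map (T.η.app X)) _).symm.trans
      ((congrArg _ (L.unit (freeAlg T X))).trans (Category.comp_id _))
  · rw [L.law_comp (freeAlg T X), law_app, ← T.mu_naturality_assoc, L.assoc (freeAlg T X),
      T.map_comp, Category.assoc]
  · rw [law_app, Category.assoc, ← L.counit (freeAlg T X), ← T.map_comp_assoc,
      W.counit_naturality, T.map_comp, Category.assoc, T.right_unit, Category.comp_id]
  · have h₂ := L.law_comp (L.alg (freeAlg T X))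
    have h₃ : T.map (W.map (W.map (T.η.app X))) ≫ L.law.app (W.obj (T.obj X)) =
        L.law.app (W.obj X) ≫ W.map (T.map (W.map (T.η.app X))) :=
      L.law.naturality (W.map (T.η.app X))
    rw [L.law_app X, W.map_comp, ← reassoc_of% h₃, h₂, Category.assoc, ← L.comult (freeAlg T X),
      ← T.map_comp_assoc, W.delta_naturality, T.map_comp, Category.assoc]

/-- Mixed distributive laws are the same as lifted actions. -/
def equivLaw (T : Monad C) (W : Comonad C) :
    {γ : W.toFunctor ⋙ T.toFunctor ⟶ T.toFunctor ⋙ W.toFunctor //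
      IsMixedDistributiveLaw T W γ} ≃ LiftedAction T W where
  toFun γ := ofLaw γ.1 γ.2
  invFun L := ⟨L.law, L.isMixedDistributiveLaw_law⟩
  left_inv γ := by
    ext X
    have : T.map (W.map (T.η.app X)) ≫ γ.1.app (T.obj X) =
      γ.1.app X ≫ W.map (T.map (T.η.app X)) := γ.1.naturality (T.η.app X)
    rw [law_app, ofLaw_act, reassoc_of% this, ← W.map_comp, T.right_unit]
    exact (congrArg _ (W.map_id _)).trans (Category.comp_id _)
  right_inv L := by
    ext A
    exact L.law_comp A

end LiftedAction

/-- There is a bijection between mixed distributive laws of the monad `T` over the comonad `W`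
and comonads on the Eilenberg–Moore category `T.Algebra` lifting `W`; under this bijection, the
lift sends a `T`-algebra `(X, a)` to the carrier `W X` with `T`-action `W a ∘ γ_X`.
(Proposition 3.13 of the paper, for `K = Cat`, via the Eilenberg–Moore embedding.) -/
theorem mixedDistributiveLaws_equiv_comonadLifts (T : Monad C) (W : Comonad C) :
    ∃ e : {γ : W.toFunctor ⋙ T.toFunctor ⟶ T.toFunctor ⋙ W.toFunctor //
            IsMixedDistributiveLaw T W γ} ≃
          {W' : Comonad T.Algebra // IsComonadLift T W W'},
      ∀ (γ : {γ : W.toFunctor ⋙ T.toFunctor ⟶ T.toFunctor ⋙ W.toFunctor //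
            IsMixedDistributiveLaw T W γ}) (A : T.Algebra),
        ∃ hc : ((e γ).val.obj A).A = W.obj A.A,
          ((e γ).val.obj A).a =
            eqToHom (congrArg T.toFunctor.obj hc) ≫ γ.val.app A.A ≫ W.map A.a ≫
              eqToHom hc.symm := by
  refine ⟨(LiftedAction.equivLaw T W).trans LiftedAction.equivComonadLift,
    fun γ A => ⟨rfl, ?_⟩⟩
  exact ((Category.id_comp _).trans (congrArg (γ.val.app A.A ≫ ·) (Category.comp_id _))).symm
end
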